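/- Let f : ℝⁿ → ℝ be a convex function, let U be uniformly distributed on the cube [-1/2, 1/2]ⁿ, and let X be a Gaussian random vector on ℝⁿ with density e^{-π‖x‖²}. Then E[f(X)] ≥ E[f(U)]. -/

import Mathlib

open MeasureTheory Real Set

/-- On a fixed interval `[-a, a]`, the even part of a convex function is largest at the endpoints. -/
lemma ConvexOn.add_neg_le_of_abs_le {g : ℝ → ℝ} (hg : ConvexOn ℝ univ g) {x a : ℝ}
    (hx : |x| ≤ a) : g x + g (-x) ≤ g a + g (-a) := by
  have hx' := abs_le.1 hx
  rcases (abs_nonneg x |>.trans hx).eq_or_lt with ha | ha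
  · have : x = 0 := by
      rw [← ha] at hx
      simpa using hx
    simp [this, ← ha]
  · have hs : 0 ≤ (a + x) / (2 * a) := div_nonneg (by linarith) (by linarith)
    have ht : 0 ≤ (a - x) / (2 * a) := div_nonneg (by linarith) (by linarith)
    have hst : (a + x) / (2 * a) + (a - x) / (2 * a) = 1 := by field_simp; ring
    have h1 := hg.2 (mem_univ a) (mem_univ (-a)) hs ht hst
    have h2 := hg.2 (mem_univ a) (mem_univ (-a)) ht hs (by rw [add_comm, hst])
    have e1 : ((a + x) / (2 * a)) • a + ((a - x) / (2 * a)) • (-a) = x := by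
      simp only [smul_eq_mul]; field_simp; ring
    have e2 : ((a - x) / (2 * a)) • a + ((a + x) / (2 * a)) • (-a) = -x := by
      simp only [smul_eq_mul]; field_simp; ring
    rw [e1] at h1
    rw [e2] at h2
    simp only [smul_eq_mul] at h1 h2
    calc g x + g (-x) ≤ ((a + x) / (2 * a) + (a - x) / (2 * a)) * (g a + g (-a)) := by linarith
      _ = g a + g (-a) := by rw [hst, one_mul]

lemma lintegral_exp_neg_pi_mul_sq : ∫⁻ x : ℝ, ENNReal.ofReal (exp (-π * x ^ 2)) = 1 := by
  rw [← ofReal_integral_eq_lintegral_ofReal (integrable_exp_neg_mul_sq pi_pos)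
    (.of_forall fun x => (exp_pos _).le), integral_gaussian, div_self pi_ne_zero]
  simp

/-- Reflecting the integrand shows that only its even part matters for an even weight. -/
lemma lintegral_ofReal_even_part_mul {g : ℝ → ℝ} (hg : Measurable g) (hpos : ∀ x, 0 ≤ g x)
    {w : ℝ → ENNReal} (hw : Measurable w) (heven : ∀ x, w (-x) = w x) :
    ∫⁻ x, ENNReal.ofReal (g x + g (-x)) * w x = 2 * ∫⁻ x, ENNReal.ofReal (g x) * w x := by
  have h := lintegral_neg_eq_self (μ := volume) fun x : ℝ => ENNReal.ofReal (g x) * w x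
  simp_rw [heven] at h
  simp_rw [fun x => ENNReal.ofReal_add (hpos x) (hpos (-x)), add_mul]
  rw [lintegral_add_left (by fun_prop), h, two_mul]

/-- The one-dimensional comparison: the two densities cross only at `±1/2`. -/
lemma ConvexOn.lintegral_uniform_le_lintegral_gaussian {g : ℝ → ℝ} (hg : ConvexOn ℝ univ g)
    (hpos : ∀ x, 0 ≤ g x) :
    ∫⁻ x, ENNReal.ofReal (g x) * (Icc (-(1 : ℝ) / 2) (1 / 2)).indicator 1 x ≤
      ∫⁻ x, ENNReal.ofReal (g x) * ENNReal.ofReal (exp (-π * x ^ 2)) := by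
  have hgm : Measurable g := hg.locallyLipschitz.continuous.measurable
  have hI : Measurable ((Icc (-(1 : ℝ) / 2) (1 / 2)).indicator (1 : ℝ → ENNReal)) :=
    measurable_one.indicator measurableSet_Icc
  have hmem (x : ℝ) : x ∈ Icc (-(1 : ℝ) / 2) (1 / 2) ↔ |x| ≤ 1 / 2 := by
    rw [mem_Icc, abs_le, neg_div]
  have hIeven (x : ℝ) : (Icc (-(1 : ℝ) / 2) (1 / 2)).indicator (1 : ℝ → ENNReal) (-x) =
      (Icc (-(1 : ℝ) / 2) (1 / 2)).indicator 1 x := by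
    have hpre : Neg.neg ⁻¹' Icc (-(1 : ℝ) / 2) (1 / 2) = Icc (-(1 : ℝ) / 2) (1 / 2) :=
      Set.ext fun y => by rw [mem_preimage, hmem, hmem, abs_neg]
    rw [← indicator_comp_right Neg.neg, hpre]
    rfl
  have hI1 : ∫⁻ x, (Icc (-(1 : ℝ) / 2) (1 / 2)).indicator (1 : ℝ → ENNReal) x = 1 := by
    rw [lintegral_indicator_one measurableSet_Icc, Real.volume_Icc]
    norm_num
  set c := g (1 / 2) + g (-(1 / 2)) with hc
  have key : ∫⁻ x, (ENNReal.ofReal (g x + g (-x)) * (Icc (-(1 : ℝ) / 2) (1 / 2)).indicator 1 x +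
        ENNReal.ofReal c * ENNReal.ofReal (exp (-π * x ^ 2))) ≤
      ∫⁻ x, (ENNReal.ofReal (g x + g (-x)) * ENNReal.ofReal (exp (-π * x ^ 2)) +
        ENNReal.ofReal c * (Icc (-(1 : ℝ) / 2) (1 / 2)).indicator 1 x) := by
    refine lintegral_mono fun x => ?_
    have h0 : 0 ≤ g x + g (-x) := add_nonneg (hpos _) (hpos _)
    have hc0 : 0 ≤ c := add_nonneg (hpos _) (hpos _)
    have hp : 0 ≤ exp (-π * x ^ 2) := (exp_pos _).le
    by_cases hx : |x| ≤ 1 / 2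
    · have hxc := hg.add_neg_le_of_abs_le hx
      have hp1 : exp (-π * x ^ 2) ≤ 1 := by
        rw [exp_le_one_iff]
        nlinarith [pi_pos, sq_nonneg x]
      rw [indicator_of_mem ((hmem x).2 hx)]
      simp only [Pi.one_apply, mul_one]
      rw [← ENNReal.ofReal_mul hc0, ← ENNReal.ofReal_mul h0,
        ← ENNReal.ofReal_add h0 (by positivity), ← ENNReal.ofReal_add (by positivity) hc0]
      exact ENNReal.ofReal_le_ofReal (by nlinarith)
    · have hxc : c ≤ g x + g (-x) := by
        have h := hg.add_neg_le_of_abs_le (x := 1 / 2) (a := |x|)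
          (by rw [abs_of_pos (by norm_num)]; linarith)
        rcases abs_choice x with h' | h' <;> rw [h'] at h <;> linarith [neg_neg x ▸ h]
      rw [indicator_of_notMem (fun h => hx ((hmem x).1 h))]
      simp only [mul_zero, zero_add, add_zero]
      gcongr
  rw [lintegral_add_right _ (by fun_prop), lintegral_add_right _ (hI.const_mul _),
    lintegral_const_mul _ (by fun_prop), lintegral_const_mul _ hI, hI1,
    lintegral_exp_neg_pi_mul_sq, ENNReal.add_le_add_iff_right (by finiteness),
    lintegral_ofReal_even_part_mul hgm hpos hI hIeven,
    lintegral_ofReal_even_part_mul hgm hpos (by fun_prop) (by simp)] at key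
  exact (ENNReal.mul_le_mul_iff_right (by simp) (by simp)).1 key

lemma lintegral_fin_succ_mul_prod {n : ℕ} {F : (Fin (n + 1) → ℝ) → ENNReal} (hF : Measurable F)
    {w : ℝ → ENNReal} (hw : Measurable w) :
    ∫⁻ x, F x * ∏ i, w (x i) =
      ∫⁻ z : ℝ × (Fin n → ℝ), F (Fin.cons z.1 z.2) * (w z.1 * ∏ i, w (z.2 i)) := by
  rw [← (volume_preserving_piFinSuccAbove (fun _ : Fin (n + 1) => ℝ) 0).symm.lintegral_comp
    (by fun_prop)]
  refine lintegral_congr fun z => ?_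
  simp [MeasurableEquiv.piFinSuccAbove_symm_apply, Fin.insertNthEquiv, Fin.prod_univ_succ]

/-- Convex domination between two densities on the line passes to their product densities. -/
lemma ConvexOn.lintegral_mul_prod_le {w₁ w₂ : ℝ → ENNReal} (hw₁ : Measurable w₁)
    (hw₂ : Measurable w₂)
    (h : ∀ g : ℝ → ℝ, ConvexOn ℝ univ g → (∀ x, 0 ≤ g x) →
      ∫⁻ x, ENNReal.ofReal (g x) * w₁ x ≤ ∫⁻ x, ENNReal.ofReal (g x) * w₂ x)
    {n : ℕ} {f : (Fin n → ℝ) → ℝ} (hf : ConvexOn ℝ univ f) (hpos : ∀ x, 0 ≤ f x) :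
    ∫⁻ x, ENNReal.ofReal (f x) * ∏ i, w₁ (x i) ≤
      ∫⁻ x, ENNReal.ofReal (f x) * ∏ i, w₂ (x i) := by
  induction n with
  | zero => simp
  | succ n ih =>
    have hfm : Measurable f := hf.locallyLipschitz.continuous.measurable
    have hcons : Measurable fun z : ℝ × (Fin n → ℝ) => (Fin.cons z.1 z.2 : Fin (n + 1) → ℝ) := by
      refine measurable_pi_lambda _ fun i => ?_
      refine Fin.cases ?_ (fun i => ?_) i <;> simp <;> fun_prop
    have hfz : Measurable fun z : ℝ × (Fin n → ℝ) => f (Fin.cons z.1 z.2) := hfm.comp hcons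
    have hfx (x : ℝ) : Measurable fun y : Fin n → ℝ => f (Fin.cons x y) :=
      hfz.comp measurable_prodMk_left
    have hfy (y : Fin n → ℝ) : Measurable fun x : ℝ => f (Fin.cons x y) :=
      hfz.comp measurable_prodMk_right
    have hcomb {x x' : ℝ} {y y' : Fin n → ℝ} {a b : ℝ} :
        (Fin.cons (a * x + b * x') (a • y + b • y') : Fin (n + 1) → ℝ) =
          a • (Fin.cons x y : Fin (n + 1) → ℝ) + b • (Fin.cons x' y' : Fin (n + 1) → ℝ) := by
      ext i
      refine Fin.cases ?_ (fun i => ?_) i <;> simp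
    have hconvx (x : ℝ) : ConvexOn ℝ univ fun y : Fin n → ℝ => f (Fin.cons x y) := by
      refine ⟨convex_univ, fun y _ y' _ a b ha hb hab => ?_⟩
      have := hf.2 (mem_univ (Fin.cons x y)) (mem_univ (Fin.cons x y')) ha hb hab
      rwa [← hcomb, ← add_mul, hab, one_mul] at this
    have hconvy (y : Fin n → ℝ) : ConvexOn ℝ univ fun x : ℝ => f (Fin.cons x y) := by
      refine ⟨convex_univ, fun x _ x' _ a b ha hb hab => ?_⟩
      have := hf.2 (mem_univ (Fin.cons x y)) (mem_univ (Fin.cons x' y)) ha hb hab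
      rwa [← hcomb, ← add_smul, hab, one_smul] at this
    rw [lintegral_fin_succ_mul_prod (by fun_prop) hw₁,
      lintegral_fin_succ_mul_prod (by fun_prop) hw₂]
    calc ∫⁻ z : ℝ × (Fin n → ℝ), ENNReal.ofReal (f (Fin.cons z.1 z.2)) *
            (w₁ z.1 * ∏ i, w₁ (z.2 i))
        = ∫⁻ x, w₁ x * ∫⁻ y : Fin n → ℝ, ENNReal.ofReal (f (Fin.cons x y)) * ∏ i, w₁ (y i) := by
          rw [Measure.volume_eq_prod, lintegral_prod _ (by fun_prop)]
          refine lintegral_congr fun x => ?_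
          have := hfx x
          rw [← lintegral_const_mul _ (by fun_prop)]
          exact lintegral_congr fun y => by ring
      _ ≤ ∫⁻ x, w₁ x * ∫⁻ y : Fin n → ℝ, ENNReal.ofReal (f (Fin.cons x y)) * ∏ i, w₂ (y i) := by
          exact lintegral_mono fun x => mul_le_mul_right (ih (hconvx x) fun y => hpos _) _
      _ = ∫⁻ z : ℝ × (Fin n → ℝ), ENNReal.ofReal (f (Fin.cons z.1 z.2)) *
            (w₁ z.1 * ∏ i, w₂ (z.2 i)) := by
          rw [Measure.volume_eq_prod, lintegral_prod _ (by fun_prop)]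
          refine lintegral_congr fun x => ?_
          have := hfx x
          rw [← lintegral_const_mul _ (by fun_prop)]
          exact lintegral_congr fun y => by ring
      _ = ∫⁻ y : Fin n → ℝ, (∏ i, w₂ (y i)) * ∫⁻ x, ENNReal.ofReal (f (Fin.cons x y)) * w₁ x := by
          rw [Measure.volume_eq_prod, lintegral_prod_symm _ (by fun_prop)]
          refine lintegral_congr fun y => ?_
          have := hfy y
          rw [← lintegral_const_mul _ (by fun_prop)]
          exact lintegral_congr fun x => by ring
      _ ≤ ∫⁻ y : Fin n → ℝ, (∏ i, w₂ (y i)) * ∫⁻ x, ENNReal.ofReal (f (Fin.cons x y)) * w₂ x := by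
          exact lintegral_mono fun y => mul_le_mul_right (h _ (hconvy y) fun x => hpos _) _
      _ = ∫⁻ z : ℝ × (Fin n → ℝ), ENNReal.ofReal (f (Fin.cons z.1 z.2)) *
            (w₂ z.1 * ∏ i, w₂ (z.2 i)) := by
          rw [Measure.volume_eq_prod, lintegral_prod_symm _ (by fun_prop)]
          refine lintegral_congr fun y => ?_
          have := hfy y
          rw [← lintegral_const_mul _ (by fun_prop)]
          exact lintegral_congr fun x => by ring

lemma measurableSet_cube (n : ℕ) :
    MeasurableSet {x : EuclideanSpace ℝ (Fin n) | ∀ i, x i ∈ Icc (-(1 : ℝ) / 2) (1 / 2)} := by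
  rw [ofPred_forall]
  exact .iInter fun i => measurableSet_Icc.preimage (f := fun x : EuclideanSpace ℝ (Fin n) => x i)
    (by fun_prop)

lemma ConvexOn.lintegral_cube_le_lintegral_gaussian {n : ℕ} {f : EuclideanSpace ℝ (Fin n) → ℝ}
    (hf : ConvexOn ℝ univ f) (hpos : ∀ x, 0 ≤ f x) :
    ∫⁻ x in {x : EuclideanSpace ℝ (Fin n) | ∀ i, x i ∈ Icc (-(1 : ℝ) / 2) (1 / 2)},
        ENNReal.ofReal (f x) ≤
      ∫⁻ x, ENNReal.ofReal (f x * exp (-π * ‖x‖ ^ 2)) := by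
  have hfm : Measurable f := hf.locallyLipschitz.continuous.measurable
  have hC : MeasurableSet {x : EuclideanSpace ℝ (Fin n) | ∀ i, x i ∈ Icc (-(1 : ℝ) / 2) (1 / 2)} :=
    measurableSet_cube n
  have hconv : ConvexOn ℝ univ fun y : Fin n → ℝ => f (WithLp.toLp 2 y) :=
    hf.comp_linearMap (WithLp.linearEquiv 2 ℝ (Fin n → ℝ)).symm.toLinearMap
  have key := hconv.lintegral_mul_prod_le (measurable_one.indicator measurableSet_Icc)
    (w₂ := fun x => ENNReal.ofReal (exp (-π * x ^ 2))) (by fun_prop)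
    (fun g hg hg0 => hg.lintegral_uniform_le_lintegral_gaussian hg0) fun y => hpos _
  rw [← lintegral_indicator hC,
    ← (PiLp.volume_preserving_toLp (Fin n)).lintegral_comp
      (hfm.ennreal_ofReal.indicator hC),
    ← (PiLp.volume_preserving_toLp (Fin n)).lintegral_comp
      (f := fun x => ENNReal.ofReal (f x * exp (-π * ‖x‖ ^ 2))) (by fun_prop)]
  refine (lintegral_congr fun y => ?_).trans_le (key.trans_eq (lintegral_congr fun y => ?_))
  · by_cases hy : ∀ i, y i ∈ Icc (-(1 : ℝ) / 2) (1 / 2)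
    · rw [indicator_of_mem (by exact hy),
        Finset.prod_eq_one fun i _ => by rw [indicator_of_mem (hy i), Pi.one_apply], mul_one]
    · rw [indicator_of_notMem (by exact hy)]
      push Not at hy
      obtain ⟨i, hi⟩ := hy
      rw [Finset.prod_eq_zero (Finset.mem_univ i) (indicator_of_notMem hi _), mul_zero]
  · rw [ENNReal.ofReal_mul (hpos _), ← ENNReal.ofReal_prod_of_nonneg fun i _ => (exp_pos _).le,
      ← exp_sum, ← Finset.mul_sum, EuclideanSpace.real_norm_sq_eq]

theorem gaussian_dominates_uniform_for_convex
    (n : ℕ) (f : EuclideanSpace ℝ (Fin n) → ℝ)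
    (hf : ConvexOn ℝ Set.univ f)
    (C : Set (EuclideanSpace ℝ (Fin n)))
    (hC : C = {x | ∀ i, x i ∈ Set.Icc (-(1:ℝ)/2) (1/2)})
    (hint1 : Integrable (fun x => f x * Real.exp (-Real.pi * ‖x‖ ^ 2)) volume)
    (hint2 : IntegrableOn f C volume) :
    ∫ x, f x * Real.exp (-Real.pi * ‖x‖ ^ 2) ≥ ∫ x in C, f x := by
  have hCm : MeasurableSet C := by
    rw [hC]
    exact measurableSet_cube n
  have hvol : volume C = 1 := by
    have hpre : WithLp.toLp 2 ⁻¹' C = univ.pi fun _ : Fin n => Icc (-(1 : ℝ) / 2) (1 / 2) := by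
      ext y
      simp only [hC, mem_preimage, mem_univ_pi]
      rfl
    rw [← (PiLp.volume_preserving_toLp (Fin n)).measure_preimage hCm.nullMeasurableSet, hpre,
      volume_pi_pi]
    norm_num
  have hgauss : ∫ x : EuclideanSpace ℝ (Fin n), exp (-π * ‖x‖ ^ 2) = 1 := by
    rw [GaussianFourier.integral_rexp_neg_mul_sq_norm pi_pos, div_self pi_ne_zero, one_rpow]
  have hgint : Integrable fun x : EuclideanSpace ℝ (Fin n) => exp (-π * ‖x‖ ^ 2) :=
    .of_integral_ne_zero (by rw [hgauss]; exact one_ne_zero)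
  have hnegC (x) : -x ∈ C ↔ x ∈ C := by
    simp only [hC, mem_ofPred_eq, PiLp.neg_apply, mem_Icc]
    refine forall_congr' fun i => ?_
    constructor <;> rintro ⟨h1, h2⟩ <;> constructor <;> linarith
  have hind (x) : C.indicator f (-x) = C.indicator (fun x => f (-x)) x := by
    have hpre : Neg.neg ⁻¹' C = C := Set.ext hnegC
    rw [← indicator_comp_right Neg.neg, hpre]
    rfl
  have hint2' : IntegrableOn (fun x => f (-x)) C := by
    rw [← integrable_indicator_iff hCm] at hint2 ⊢
    simpa only [hind] using hint2.comp_neg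
  have hsymm2 : ∫ x in C, f (-x) = ∫ x in C, f x := by
    rw [← integral_indicator hCm, ← integral_indicator hCm,
      ← integral_neg_eq_self (C.indicator f)]
    simp only [hind]
  have hint1' : Integrable fun x => f (-x) * exp (-π * ‖x‖ ^ 2) := by
    simpa only [norm_neg] using hint1.comp_neg
  have hsymm1 : ∫ x, f (-x) * exp (-π * ‖x‖ ^ 2) = ∫ x, f x * exp (-π * ‖x‖ ^ 2) := by
    rw [← integral_neg_eq_self fun x => f x * exp (-π * ‖x‖ ^ 2)]
    simp only [norm_neg]
  set h : EuclideanSpace ℝ (Fin n) → ℝ := fun x => f x + f (-x) - 2 * f 0 with hh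
  have hconv : ConvexOn ℝ univ h := by
    have hneg : ConvexOn ℝ univ fun x => f (-x) :=
      hf.comp_linearMap (-LinearMap.id : EuclideanSpace ℝ (Fin n) →ₗ[ℝ] _)
    exact (hf.add hneg).add_const (-(2 * f 0))
  have hpos (x) : 0 ≤ h x := by
    have := hf.2 (mem_univ x) (mem_univ (-x)) (show (0 : ℝ) ≤ 1 / 2 by norm_num)
      (show (0 : ℝ) ≤ 1 / 2 by norm_num) (by norm_num)
    rw [smul_neg, add_neg_cancel, smul_eq_mul, smul_eq_mul] at this
    simp only [hh]
    linarith
  have hfin : volume C ≠ ⊤ := by simp [hvol]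
  have hcint : IntegrableOn (fun _ => 2 * f 0) C := integrableOn_const hfin
  have hintC : IntegrableOn h C := (hint2.add hint2').sub hcint
  have hmul (x) : h x * exp (-π * ‖x‖ ^ 2) = f x * exp (-π * ‖x‖ ^ 2) +
      f (-x) * exp (-π * ‖x‖ ^ 2) - 2 * f 0 * exp (-π * ‖x‖ ^ 2) := by
    simp only [hh]
    ring
  have hintG : Integrable fun x => h x * exp (-π * ‖x‖ ^ 2) := by
    simp only [hmul]
    exact (hint1.add hint1').sub (hgint.const_mul _)
  have hvalC : ∫ x in C, h x = 2 * (∫ x in C, f x) - 2 * f 0 := by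
    simp only [hh]
    rw [integral_sub (f := fun x => f x + f (-x)) (hint2.add hint2') hcint, integral_add hint2 hint2', hsymm2,
      setIntegral_const, measureReal_def, hvol]
    simp [two_mul]
  have hvalG : ∫ x, h x * exp (-π * ‖x‖ ^ 2) =
      2 * (∫ x, f x * exp (-π * ‖x‖ ^ 2)) - 2 * f 0 := by
    simp only [hmul]
    rw [integral_sub (f := fun x => f x * exp (-π * ‖x‖ ^ 2) + f (-x) * exp (-π * ‖x‖ ^ 2))
      (hint1.add hint1') (hgint.const_mul _), integral_add hint1 hint1', hsymm1,
      integral_const_mul, hgauss]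
    ring
  have hposG (x) : 0 ≤ h x * exp (-π * ‖x‖ ^ 2) := mul_nonneg (hpos x) (exp_pos _).le
  have key := hconv.lintegral_cube_le_lintegral_gaussian hpos
  rw [← hC, ← ofReal_integral_eq_lintegral_ofReal hintC (.of_forall hpos),
    ← ofReal_integral_eq_lintegral_ofReal hintG (.of_forall hposG),
    ENNReal.ofReal_le_ofReal_iff (integral_nonneg hposG), hvalC, hvalG] at key
  linarith
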